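/- Let Φ_H(u) = max(1+u, 0) be the hinge loss and assume max_{j=1,…,M} ‖φ_j‖_{P_X,∞} ≤ L_φ. Then for ANY prior probability measure π on Λ = {λ ∈ ℝ^M : ‖λ‖₁ ≤ R} and any β > 0, the mirror averaging aggregate f̂_n satisfies: E[ℓ_{Φ_H}(f̂_n, f)] ≤ inf over probability measures p on Λ of ( ∫_Λ ℓ_{Φ_H}(f_λ, f) p(dλ) + β·KL(p,π)/(n+1) ) + (2(1+RL_φ)²/β) e^{(1+RL_φ)/β}. -/

import Mathlib

open MeasureTheory

lemma exp_neg_le_quadratic {x : ℝ} (hx : 0 ≤ x) : Real.exp (-x) ≤ 1 - x + x ^ 2 / 2 := by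
  have h := Real.quadratic_le_exp_of_nonneg hx
  rw [Real.exp_neg, inv_le_iff_one_le_mul₀ (Real.exp_pos x)]
  have h0 : 0 ≤ 1 - x + x ^ 2 / 2 := by nlinarith [sq_nonneg (x - 1)]
  nlinarith [mul_le_mul_of_nonneg_left h h0, sq_nonneg (x ^ 2)]

lemma integrable_of_mem_Icc {α : Type*} [MeasurableSpace α] {μ : Measure α} [IsFiniteMeasure μ]
    {f : α → ℝ} (hf : Measurable f) {C : ℝ} (h : ∀ a, f a ∈ Set.Icc 0 C) : Integrable f μ :=
  Integrable.of_mem_Icc 0 C hf.aemeasurable (ae_of_all _ h)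

section Gibbs

variable {Λ Z : Type*}

/-- The cumulative loss over the first `m` observations. -/
def cumLoss (q : Λ → Z → ℝ) {n : ℕ} (m : ℕ) (z : Fin n → Z) (l : Λ) : ℝ :=
  ∑ i ∈ Finset.univ.filter (fun i : Fin n => (i : ℕ) < m), q l (z i)

lemma cumLoss_nonneg {q : Λ → Z → ℝ} (hq : ∀ l z, 0 ≤ q l z) {n : ℕ} (m : ℕ) (z : Fin n → Z)
    (l : Λ) : 0 ≤ cumLoss q m z l :=
  Finset.sum_nonneg fun _ _ => hq _ _

lemma cumLoss_comp_succAbove (q : Λ → Z → ℝ) {n : ℕ} (m : Fin (n + 1)) (z : Fin (n + 1) → Z)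
    (l : Λ) : cumLoss q m (fun i => z (m.succAbove i)) l = cumLoss q m z l := by
  simp only [cumLoss, Finset.sum_filter]
  rw [Fin.sum_univ_succAbove _ m, if_neg (lt_irrefl _), zero_add]
  refine Finset.sum_congr rfl fun i _ => ?_
  rcases lt_or_ge i.castSucc m with h | h
  · rw [Fin.succAbove_of_castSucc_lt _ _ h]; rfl
  · rw [Fin.succAbove_of_le_castSucc _ _ h, if_neg, if_neg]
    · have : (m : ℕ) ≤ i := h
      simp only [Fin.val_succ]; omega
    · have : (m : ℕ) ≤ i := h
      omega

lemma cumLoss_succ (q : Λ → Z → ℝ) {n : ℕ} (m : Fin n) (z : Fin n → Z) (l : Λ) :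
    cumLoss q (m + 1) z l = cumLoss q m z l + q l (z m) := by
  have : Finset.univ.filter (fun i : Fin n => (i : ℕ) < m + 1)
      = insert m (Finset.univ.filter fun i : Fin n => (i : ℕ) < m) := by
    ext i; simp only [Finset.mem_filter, Finset.mem_univ, true_and, Finset.mem_insert, Fin.ext_iff]
    omega
  rw [cumLoss, this, Finset.sum_insert (by simp), add_comm, cumLoss]

variable [MeasurableSpace Λ] [MeasurableSpace Z]

/-- The density with respect to `π` of the Gibbs measure with energy `S` and temperature `β`. -/
noncomputable def gibbsDensity (π : Measure Λ) (β : ℝ) (S : Λ → ℝ) (l : Λ) : ℝ :=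
  Real.exp (-(S l) / β) / ∫ w, Real.exp (-(S w) / β) ∂π

lemma exp_neg_div_mem_Icc {s β : ℝ} (hβ : 0 < β) (hs : 0 ≤ s) :
    Real.exp (-s / β) ∈ Set.Icc (0 : ℝ) 1 :=
  ⟨(Real.exp_pos _).le, Real.exp_le_one_iff.2 (div_nonpos_of_nonpos_of_nonneg (by linarith) hβ.le)⟩

lemma integrable_exp_neg_div {π : Measure Λ} [IsFiniteMeasure π] {β : ℝ} (hβ : 0 < β)
    {S : Λ → ℝ} (hS : Measurable S) (hS0 : ∀ l, 0 ≤ S l) :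
    Integrable (fun l => Real.exp (-(S l) / β)) π :=
  integrable_of_mem_Icc (by fun_prop) fun l => exp_neg_div_mem_Icc hβ (hS0 l)

lemma integral_exp_neg_div_pos {π : Measure Λ} [IsProbabilityMeasure π] {β : ℝ} (hβ : 0 < β)
    {S : Λ → ℝ} (hS : Measurable S) (hS0 : ∀ l, 0 ≤ S l) :
    0 < ∫ l, Real.exp (-(S l) / β) ∂π :=
  integral_exp_pos (integrable_exp_neg_div hβ hS hS0)

lemma gibbsDensity_nonneg (π : Measure Λ) (β : ℝ) (S : Λ → ℝ) (l : Λ) :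
    0 ≤ gibbsDensity π β S l :=
  div_nonneg (Real.exp_pos _).le (integral_nonneg fun _ => (Real.exp_pos _).le)

lemma integrable_gibbsDensity {π : Measure Λ} [IsFiniteMeasure π] {β : ℝ} (hβ : 0 < β)
    {S : Λ → ℝ} (hS : Measurable S) (hS0 : ∀ l, 0 ≤ S l) :
    Integrable (gibbsDensity π β S) π :=
  (integrable_exp_neg_div hβ hS hS0).div_const _

lemma integral_gibbsDensity {π : Measure Λ} [IsProbabilityMeasure π] {β : ℝ} (hβ : 0 < β)
    {S : Λ → ℝ} (hS : Measurable S) (hS0 : ∀ l, 0 ≤ S l) :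
    ∫ l, gibbsDensity π β S l ∂π = 1 := by
  simp only [gibbsDensity]
  rw [integral_div, div_self (integral_exp_neg_div_pos hβ hS hS0).ne']

lemma integrable_gibbsDensity_mul {π : Measure Λ} [IsFiniteMeasure π] {β : ℝ} (hβ : 0 < β)
    {S g : Λ → ℝ} (hS : Measurable S) (hS0 : ∀ l, 0 ≤ S l) (hg : AEMeasurable g π) {B : ℝ}
    (hB : ∀ᵐ l ∂π, |g l| ≤ B) :
    Integrable (fun l => gibbsDensity π β S l * g l) π :=
  (integrable_gibbsDensity hβ hS hS0).mul_bdd (c := B) hg.aestronglyMeasurable hB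

lemma integral_gibbsDensity_mul_mem_Icc {π : Measure Λ} [IsProbabilityMeasure π] {β : ℝ}
    (hβ : 0 < β) {S g : Λ → ℝ} (hS : Measurable S) (hS0 : ∀ l, 0 ≤ S l) (hg : Measurable g)
    {B : ℝ} (hB : ∀ l, g l ∈ Set.Icc 0 B) :
    ∫ l, gibbsDensity π β S l * g l ∂π ∈ Set.Icc 0 B := by
  refine ⟨integral_nonneg fun l => mul_nonneg (gibbsDensity_nonneg _ _ _ _) (hB l).1, ?_⟩
  calc ∫ l, gibbsDensity π β S l * g l ∂π ≤ ∫ l, gibbsDensity π β S l * B ∂π := by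
        refine integral_mono (integrable_gibbsDensity_mul hβ hS hS0 hg.aemeasurable
          (ae_of_all _ fun l => by rw [abs_of_nonneg (hB l).1]; exact (hB l).2))
          ((integrable_gibbsDensity hβ hS hS0).mul_const B) fun l => ?_
        exact mul_le_mul_of_nonneg_left (hB l).2 (gibbsDensity_nonneg _ _ _ _)
    _ = B := by rw [integral_mul_const, integral_gibbsDensity hβ hS hS0, one_mul]

/-- The mean of a bounded loss under a Gibbs measure exceeds the mix loss by at most
`B ^ 2 / (2 β)`. -/
lemma integral_gibbsDensity_mul_le {π : Measure Λ} [IsProbabilityMeasure π] {β : ℝ} (hβ : 0 < β)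
    {S g : Λ → ℝ} (hS : Measurable S) (hS0 : ∀ l, 0 ≤ S l) (hg : Measurable g)
    {B : ℝ} (hB : ∀ l, g l ∈ Set.Icc 0 B) :
    ∫ l, gibbsDensity π β S l * g l ∂π ≤
      β * (Real.log (∫ l, Real.exp (-(S l) / β) ∂π)
        - Real.log (∫ l, Real.exp (-(S l + g l) / β) ∂π)) + B ^ 2 / (2 * β) := by
  have hW := integral_exp_neg_div_pos (π := π) hβ hS hS0
  have hW' := integral_exp_neg_div_pos (π := π) hβ (hS.add hg) fun l => add_nonneg (hS0 l) (hB l).1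
  have hi := integrable_exp_neg_div (π := π) hβ hS hS0
  have hi' := integrable_exp_neg_div (π := π) hβ (hS.add hg) fun l => add_nonneg (hS0 l) (hB l).1
  simp only [Pi.add_apply] at hW' hi'
  have hig : Integrable (fun l => gibbsDensity π β S l * g l) π :=
    integrable_gibbsDensity_mul hβ hS hS0 hg.aemeasurable
      (ae_of_all _ fun l => by rw [abs_of_nonneg (hB l).1]; exact (hB l).2)
  set W := ∫ l, Real.exp (-(S l) / β) ∂π with hWdef
  set A := ∫ l, gibbsDensity π β S l * g l ∂π with hA
  have hbound : ∫ l, Real.exp (-(S l + g l) / β) ∂π ≤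
      W * Real.exp (-(A / β) + B ^ 2 / (2 * β ^ 2)) :=
    calc ∫ l, Real.exp (-(S l + g l) / β) ∂π
        ≤ ∫ l, ((1 + B ^ 2 / (2 * β ^ 2)) * Real.exp (-(S l) / β)
            - W / β * (gibbsDensity π β S l * g l)) ∂π := by
          refine integral_mono hi' ((hi.const_mul _).sub (hig.const_mul _)) fun l => ?_
          have h0 : 0 ≤ g l / β := div_nonneg (hB l).1 hβ.le
          have h1 : g l / β ≤ B / β := div_le_div_of_nonneg_right (hB l).2 hβ.le
          have h2 : (g l / β) ^ 2 ≤ (B / β) ^ 2 := pow_le_pow_left₀ h0 h1 2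
          have h3 := exp_neg_le_quadratic h0
          have h4 : Real.exp (-(S l + g l) / β) = Real.exp (-(S l) / β) * Real.exp (-(g l / β)) := by
            rw [← Real.exp_add]; congr 1; ring
          have h5 : W / β * (gibbsDensity π β S l * g l) = Real.exp (-(S l) / β) * (g l / β) := by
            simp only [gibbsDensity, ← hWdef]
            field_simp
          have h6 : B ^ 2 / (2 * β ^ 2) = (B / β) ^ 2 / 2 := by field_simp
          simp only [h4, h5, h6]
          have h7 := mul_le_mul_of_nonneg_left
            (h3.trans (show _ ≤ 1 + (B / β) ^ 2 / 2 - g l / β by linarith))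
            (Real.exp_pos (-(S l) / β)).le
          linarith
      _ = W * (-(A / β) + B ^ 2 / (2 * β ^ 2) + 1) := by
          rw [integral_sub (hi.const_mul _) (hig.const_mul _), integral_const_mul,
            integral_const_mul, ← hWdef, ← hA]
          ring
      _ ≤ _ := mul_le_mul_of_nonneg_left (Real.add_one_le_exp _) hW.le
  have hlog := Real.log_le_log hW' hbound
  rw [Real.log_mul hW.ne' (Real.exp_pos _).ne', Real.log_exp] at hlog
  have h8 := mul_le_mul_of_nonneg_left hlog hβ.le
  have h9 : β * (Real.log W + (-(A / β) + B ^ 2 / (2 * β ^ 2)))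
      = β * Real.log W - A + B ^ 2 / (2 * β) := by field_simp; ring
  linarith

/-- The Donsker–Varadhan inequality for a measurable energy. -/
lemma neg_log_integral_exp_le {π p : Measure Λ} [IsProbabilityMeasure π] [IsProbabilityMeasure p]
    (hp : p ≪ π) (hllr : Integrable (llr p π) p) {f : Λ → ℝ} (hfp : Integrable f p)
    (hf : Integrable (fun l => Real.exp (-f l)) π) :
    -Real.log (∫ l, Real.exp (-f l) ∂π) ≤ ∫ l, f l ∂p + ∫ l, llr p π l ∂p := by
  have := isProbabilityMeasure_tilted hf
  have h := integral_llr_tilted_right hp hfp.neg hf hllr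
  have h0 : 0 ≤ ∫ l, llr p (π.tilted fun l => -f l) l ∂p := by
    rw [← InformationTheory.toReal_klDiv_of_measure_eq
      (hp.trans (absolutelyContinuous_tilted hf)) (by simp)]
    exact ENNReal.toReal_nonneg
  have h1 : ∫ l, (-f) l ∂p = -∫ l, f l ∂p := integral_neg f
  change ∫ l, llr p (π.tilted fun l => -f l) l ∂p = ∫ l, llr p π l ∂p - ∫ l, (-f) l ∂p
    + Real.log (∫ l, Real.exp (-f l) ∂π) at h
  linarith

lemma measurable_uncurry_cumLoss {q : Λ → Z → ℝ} (hq : Measurable (Function.uncurry q)) (n m : ℕ) :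
    Measurable fun a : (Fin n → Z) × Λ => cumLoss q m a.1 a.2 :=
  Finset.measurable_sum _ fun i _ =>
    hq.comp (measurable_snd.prodMk ((measurable_pi_apply i).comp measurable_fst))

lemma measurable_uncurry_gibbsDensity_cumLoss {π : Measure Λ} [SFinite π] (β : ℝ)
    {q : Λ → Z → ℝ} (hq : Measurable (Function.uncurry q)) (n m : ℕ) :
    Measurable fun a : (Fin n → Z) × Λ => gibbsDensity π β (cumLoss q m a.1) a.2 := by
  have h : Measurable fun a : (Fin n → Z) × Λ => Real.exp (-(cumLoss q m a.1 a.2) / β) :=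
    ((measurable_uncurry_cumLoss hq n m).neg.div_const β).exp
  exact h.div (h.stronglyMeasurable.integral_prod_right'.measurable.comp measurable_fst)

/-- Online regret bound for Gibbs mixtures: the cumulative mean loss along a sequence of
observations. -/
lemma sum_integral_gibbsDensity_mul_le {π p : Measure Λ} [IsProbabilityMeasure π]
    [IsProbabilityMeasure p] (hp : p ≪ π) (hllr : Integrable (llr p π) p) {β : ℝ} (hβ : 0 < β)
    {q : Λ → Z → ℝ} (hq : Measurable (Function.uncurry q)) {B : ℝ}
    (hB : ∀ l z, q l z ∈ Set.Icc 0 B) {n : ℕ} (z : Fin n → Z) :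
    ∑ m : Fin n, ∫ l, gibbsDensity π β (cumLoss q m z) l * q l (z m) ∂π ≤
      ∑ m : Fin n, ∫ l, q l (z m) ∂p + β * ∫ l, llr p π l ∂p + n * (B ^ 2 / (2 * β)) := by
  have hqm : ∀ w, Measurable fun l => q l w := fun w => hq.comp measurable_prodMk_right
  have hSm : ∀ m, Measurable (cumLoss q m z) := fun m =>
    (measurable_uncurry_cumLoss hq n m).comp measurable_prodMk_left
  have hS0 : ∀ m l, 0 ≤ cumLoss q m z l := fun m => cumLoss_nonneg (fun l z => (hB l z).1) m z
  set F : ℕ → ℝ := fun k => Real.log (∫ l, Real.exp (-(cumLoss q k z l) / β) ∂π) with hF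
  have hstep : ∀ m : Fin n, ∫ l, gibbsDensity π β (cumLoss q m z) l * q l (z m) ∂π ≤
      β * (F m - F (m + 1)) + B ^ 2 / (2 * β) := fun m => by
    simp only [hF, cumLoss_succ]
    exact integral_gibbsDensity_mul_le hβ (hSm m) (hS0 m) (hqm _) fun l => hB l _
  have hF0 : F 0 = 0 := by simp [hF, cumLoss]
  have hint : ∀ w, Integrable (fun l => q l w) p := fun w =>
    integrable_of_mem_Icc (hqm w) fun l => hB l w
  have hSn : cumLoss q n z = fun l => ∑ i, q l (z i) := by
    ext l; simp [cumLoss]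
  have hdv := neg_log_integral_exp_le hp hllr (f := fun l => cumLoss q n z l / β)
    (by rw [hSn]; exact (integrable_finsetSum _ fun i _ => hint _).div_const β)
    (by simpa only [neg_div] using integrable_exp_neg_div (π := π) hβ (hSm n) (hS0 n))
  have hFn : -F n ≤ (∑ i, ∫ l, q l (z i) ∂p) / β + ∫ l, llr p π l ∂p := by
    simp only [hF, neg_div]
    rw [integral_div, hSn, integral_finsetSum _ fun i _ => hint _] at hdv
    rwa [hSn]
  calc _ ≤ ∑ m : Fin n, (β * (F m - F (m + 1)) + B ^ 2 / (2 * β)) :=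
        Finset.sum_le_sum fun m _ => hstep m
    _ = β * -F n + n * (B ^ 2 / (2 * β)) := by
        rw [Finset.sum_add_distrib, ← Finset.mul_sum,
          Fin.sum_univ_eq_sum_range (fun m => F m - F (m + 1)), Finset.sum_range_sub', hF0]
        simp
    _ ≤ _ := by
        have := mul_le_mul_of_nonneg_left hFn hβ.le
        have h2 : β * ((∑ i, ∫ l, q l (z i) ∂p) / β + ∫ l, llr p π l ∂p)
          = ∑ i, ∫ l, q l (z i) ∂p + β * ∫ l, llr p π l ∂p := by field_simp
        linarith

lemma measurable_integral_gibbsDensity_mul {Y : Type*} [MeasurableSpace Y] {π : Measure Λ}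
    [SFinite π] (β : ℝ) {q : Λ → Z → ℝ} (hq : Measurable (Function.uncurry q)) {g : Λ → Y → ℝ}
    (hg : Measurable (Function.uncurry g)) (n m : ℕ) :
    Measurable fun a : Y × (Fin n → Z) =>
      ∫ l, gibbsDensity π β (cumLoss q m a.2) l * g l a.1 ∂π := by
  have h : Measurable fun b : (Y × (Fin n → Z)) × Λ =>
      gibbsDensity π β (cumLoss q m b.1.2) b.2 * g b.2 b.1.1 :=
    ((measurable_uncurry_gibbsDensity_cumLoss β hq n m).comp
      ((measurable_snd.comp measurable_fst).prodMk measurable_snd)).mul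
      (hg.comp (measurable_snd.prodMk (measurable_fst.comp measurable_fst)))
  exact h.stronglyMeasurable.integral_prod_right'.measurable

lemma integral_gibbsDensity_cumLoss_mul_mem_Icc {π : Measure Λ} [IsProbabilityMeasure π] {β : ℝ}
    (hβ : 0 < β) {q : Λ → Z → ℝ} (hq : Measurable (Function.uncurry q)) {B : ℝ}
    (hB : ∀ l z, q l z ∈ Set.Icc 0 B) {n : ℕ} (m : ℕ) (a : Z × (Fin n → Z)) :
    ∫ l, gibbsDensity π β (cumLoss q m a.2) l * q l a.1 ∂π ∈ Set.Icc 0 B :=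
  integral_gibbsDensity_mul_mem_Icc hβ
    ((measurable_uncurry_cumLoss hq n m).comp measurable_prodMk_left)
    (cumLoss_nonneg (fun l z => (hB l z).1) m a.2) (hq.comp measurable_prodMk_right)
    fun l => hB l _

/-- A PAC-Bayes bound for the averaged risk of the sequence of Gibbs measures built on
i.i.d. observations. -/
lemma sum_integral_risk_gibbs_le {π p : Measure Λ} [IsProbabilityMeasure π]
    [IsProbabilityMeasure p] (hp : p ≪ π) (hllr : Integrable (llr p π) p) {β : ℝ} (hβ : 0 < β)
    {q : Λ → Z → ℝ} (hq : Measurable (Function.uncurry q)) {B : ℝ}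
    (hB : ∀ l z, q l z ∈ Set.Icc 0 B) (P : Measure Z) [IsProbabilityMeasure P] (n : ℕ) :
    ∑ m ∈ Finset.range (n + 1), ∫ z, ∫ w, ∫ l, gibbsDensity π β (cumLoss q m z) l * q l w ∂π ∂P
        ∂(Measure.pi fun _ : Fin n => P) ≤
      (n + 1) * ∫ l, ∫ w, q l w ∂P ∂p + β * ∫ l, llr p π l ∂p
        + (n + 1) * (B ^ 2 / (2 * β)) := by
  have hqm : ∀ w, Measurable fun l => q l w := fun w => hq.comp measurable_prodMk_right
  set H : ℕ → Z × (Fin n → Z) → ℝ := fun m a =>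
    ∫ l, gibbsDensity π β (cumLoss q m a.2) l * q l a.1 ∂π with hH
  have hHm : ∀ m, Measurable (H m) := measurable_integral_gibbsDensity_mul β hq hq n
  have hHB : ∀ m a, H m a ∈ Set.Icc 0 B := integral_gibbsDensity_cumLoss_mul_mem_Icc hβ hq hB
  have hmp := fun m : Fin (n + 1) => measurePreserving_piFinSuccAbove (fun _ => P) m
  have hswap : ∀ m : Fin (n + 1), ∫ z, ∫ w, H m (w, z) ∂P ∂(Measure.pi fun _ : Fin n => P)
      = ∫ z, H m (z m, fun i => z (m.succAbove i)) ∂(Measure.pi fun _ : Fin (n + 1) => P) := by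
    intro m
    rw [← integral_prod_symm _ (integrable_of_mem_Icc (hHm m) (hHB m)),
      ← (hmp m).integral_comp']
    rfl
  have hint : ∀ m : Fin (n + 1), Integrable
      (fun z : Fin (n + 1) → Z => H m (z m, fun i => z (m.succAbove i)))
      (Measure.pi fun _ : Fin (n + 1) => P) := fun m =>
    integrable_of_mem_Icc ((hHm m).comp ((measurable_pi_apply m).prodMk
      (measurable_pi_lambda _ fun i => measurable_pi_apply _))) fun z => hHB m _
  have hqp : Measurable fun w => ∫ l, q l w ∂p :=
    (hq.comp measurable_swap).stronglyMeasurable.integral_prod_right'.measurable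
  have hqpB : ∀ w, ∫ l, q l w ∂p ∈ Set.Icc 0 B := fun w => by
    have hi := integrable_of_mem_Icc (μ := p) (hqm w) fun l => hB l w
    refine ⟨integral_nonneg fun l => (hB l w).1, ?_⟩
    simpa using integral_mono hi (integrable_const B) fun l => (hB l w).2
  have hqpi : ∀ m : Fin (n + 1), Integrable (fun z : Fin (n + 1) → Z => ∫ l, q l (z m) ∂p)
      (Measure.pi fun _ : Fin (n + 1) => P) := fun m =>
    integrable_of_mem_Icc (hqp.comp (measurable_pi_apply m)) fun z => hqpB _
  have hfub : ∫ w, ∫ l, q l w ∂p ∂P = ∫ l, ∫ w, q l w ∂P ∂p :=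
    (integral_integral_swap (integrable_of_mem_Icc hq fun a => hB a.1 a.2)).symm
  rw [Finset.sum_range fun m => ∫ z, ∫ w, H m (w, z) ∂P ∂(Measure.pi fun _ : Fin n => P)]
  calc ∑ m : Fin (n + 1), ∫ z, ∫ w, H m (w, z) ∂P ∂(Measure.pi fun _ : Fin n => P)
      = ∫ z, ∑ m : Fin (n + 1), H m (z m, fun i => z (m.succAbove i))
          ∂(Measure.pi fun _ : Fin (n + 1) => P) := by
        rw [integral_finsetSum _ fun m _ => hint m]
        exact Finset.sum_congr rfl fun m _ => hswap m
    _ ≤ ∫ z, (∑ m : Fin (n + 1), ∫ l, q l (z m) ∂p + (β * ∫ l, llr p π l ∂p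
          + (n + 1 : ℕ) * (B ^ 2 / (2 * β)))) ∂(Measure.pi fun _ : Fin (n + 1) => P) := by
        refine integral_mono (integrable_finsetSum _ fun m _ => hint m)
          ((integrable_finsetSum _ fun m _ => hqpi m).add (integrable_const _)) fun z => ?_
        have h := sum_integral_gibbsDensity_mul_le hp hllr hβ hq hB z
        simp only [hH, funext (cumLoss_comp_succAbove q _ z)]
        rwa [← add_assoc]
    _ = _ := by
        have hev : ∀ m : Fin (n + 1), ∫ z : Fin (n + 1) → Z, ∫ l, q l (z m) ∂p
            ∂(Measure.pi fun _ : Fin (n + 1) => P) = ∫ l, ∫ w, q l w ∂P ∂p := fun m => by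
          rw [← hfub]
          exact integral_comp_eval (μ := fun _ : Fin (n + 1) => P) (i := m)
            hqp.aestronglyMeasurable
        rw [integral_add (integrable_finsetSum _ fun m _ => hqpi m) (integrable_const _),
          integral_finsetSum _ fun m _ => hqpi m, Finset.sum_congr rfl fun m _ => hev m]
        simp [add_assoc]

end Gibbs

/-- Jensen's inequality for the hinge loss under the density `g`. -/
lemma one_sub_mul_integral_le_of_hinge_eq {Λ : Type*} [MeasurableSpace Λ] {π : Measure Λ}
    {g f q : Λ → ℝ} {y : ℝ}
    (hg0 : ∀ l, 0 ≤ g l) (hg : Integrable g π) (hg1 : ∫ l, g l ∂π = 1)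
    (hgf : Integrable (fun l => g l * f l) π) (hgq : Integrable (fun l => g l * q l) π)
    (hq : ∀ᵐ l ∂π, max (1 - y * f l) 0 = q l) :
    1 - y * ∫ l, g l * f l ∂π ≤ ∫ l, g l * q l ∂π := by
  calc 1 - y * ∫ l, g l * f l ∂π = ∫ l, (g l - y * (g l * f l)) ∂π := by
        rw [integral_sub hg (hgf.const_mul y), integral_const_mul, hg1]
    _ ≤ _ := by
        refine integral_mono_ae (hg.sub (hgf.const_mul y)) hgq ?_
        filter_upwards [hq] with l hl
        rw [← hl]
        nlinarith [mul_le_mul_of_nonneg_left (le_max_left (1 - y * f l) 0) (hg0 l)]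

lemma abs_sum_mul_le {ι : Type*} [Fintype ι] {l a : ι → ℝ} {R L : ℝ} (hL : 0 ≤ L)
    (hl : ∑ j, |l j| ≤ R) (ha : ∀ j, |a j| ≤ L) : |∑ j, l j * a j| ≤ R * L := by
  calc |∑ j, l j * a j| ≤ ∑ j, |l j * a j| := Finset.abs_sum_le_sum_abs _ _
    _ ≤ ∑ j, |l j| * L := Finset.sum_le_sum fun j _ => by
        rw [abs_mul]; exact mul_le_mul_of_nonneg_left (ha j) (abs_nonneg _)
    _ = (∑ j, |l j|) * L := (Finset.sum_mul ..).symm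
    _ ≤ R * L := mul_le_mul_of_nonneg_right hl hL

/-- Classification under the hinge loss `Φ_H(u) = max(1+u,0)`.  For ANY prior
probability measure `π` on `Λ = {λ : ‖λ‖₁ ≤ R}` and any `β > 0`, the mirror averaging
aggregate satisfies
`E[ℓ_{Φ_H}(f̂_n,f)] ≤ inf_p ( ∫ ℓ_{Φ_H}(f_λ,f) p(dλ) + β·KL(p,π)/(n+1) )
  + (2(1+RL_φ)²/β)·e^{(1+RL_φ)/β}`. -/
theorem ma_hinge_pac_bayes
    {X : Type} [MeasurableSpace X]
    (n M : ℕ)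
    (R : ℝ) (hRpos : 0 < R)
    (P : Measure (X × ℝ)) [IsProbabilityMeasure P]
    (hlabels : ∀ᵐ z ∂P, z.2 = 1 ∨ z.2 = -1)
    (PX : Measure X) (hPX : PX = P.map Prod.fst)
    -- the regression function η(x) = E(Y₁ | X₁ = x)
    (η : X → ℝ) (hηmeas : Measurable η)
    (hη : ∀ A : Set X, MeasurableSet A →
      (∫ z in {z : X × ℝ | z.1 ∈ A}, z.2 ∂P) = ∫ x in A, η x ∂PX)
    -- the dictionary, bounded by L_φ
    (φ : Fin M → X → ℝ) (hφmeas : ∀ j, Measurable (φ j))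
    (Lφ : ℝ) (hLφ : 0 < Lφ)
    (hφbound : ∀ j, ∀ᵐ x ∂PX, |φ j x| ≤ Lφ)
    (flam : (Fin M → ℝ) → X → ℝ)
    (hflam : ∀ (l : Fin M → ℝ) (x : X), flam l x = ∑ j, l j * φ j x)
    (β : ℝ) (hβpos : 0 < β)
    -- an arbitrary prior probability measure π supported on the ℓ₁-ball of radius R
    (π : Measure (Fin M → ℝ)) [IsProbabilityMeasure π]
    (hπsupp : π {l : Fin M → ℝ | ¬ (∑ j, |l j|) ≤ R} = 0)
    -- the mirror averaging aggregate with Q(z,g) = max(1 − y g(x), 0)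
    (θ : ℕ → (Fin n → X × ℝ) → (Fin M → ℝ) → ℝ)
    (hθ : ∀ (m : ℕ) (z : Fin n → X × ℝ) (l : Fin M → ℝ), θ m z l =
      Real.exp (-(∑ i ∈ Finset.univ.filter (fun i : Fin n => (i : ℕ) < m),
          max (1 - (z i).2 * flam l (z i).1) 0) / β) /
        ∫ w, Real.exp (-(∑ i ∈ Finset.univ.filter (fun i : Fin n => (i : ℕ) < m),
          max (1 - (z i).2 * flam w (z i).1) 0) / β) ∂π)
    (fhat : (Fin n → X × ℝ) → X → ℝ)
    (hfhat : ∀ (z : Fin n → X × ℝ) (x : X), fhat z x =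
      ((n : ℝ) + 1)⁻¹ * ∑ m ∈ Finset.range (n + 1), ∫ l, θ m z l * flam l x ∂π) :
    ∀ p : Measure (Fin M → ℝ), IsProbabilityMeasure p → p ≪ π →
      Integrable (fun l => Real.log ((p.rnDeriv π l).toReal)) p →
      Integrable (fun l => (∫ w, max (1 - w.2 * flam l w.1) 0 ∂P) -
        ∫ w, max (1 - w.2 * Real.sign (η w.1)) 0 ∂P) p →
      (∫ z, ((∫ w, max (1 - w.2 * fhat z w.1) 0 ∂P) -
          ∫ w, max (1 - w.2 * Real.sign (η w.1)) 0 ∂P)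
          ∂(Measure.pi fun _ : Fin n => P)) ≤
        (∫ l, ((∫ w, max (1 - w.2 * flam l w.1) 0 ∂P) -
            ∫ w, max (1 - w.2 * Real.sign (η w.1)) 0 ∂P) ∂p) +
          β * (∫ l, Real.log ((p.rnDeriv π l).toReal) ∂p) / (n + 1) +
          2 * (1 + R * Lφ) ^ 2 / β * Real.exp ((1 + R * Lφ) / β) := by
  intro p _ hp hllr hexc
  have hB0 : 0 ≤ 1 + R * Lφ := by positivity
  set B := 1 + R * Lφ
  set c := ∫ w, max (1 - w.2 * Real.sign (η w.1)) 0 ∂P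
  set loss : (Fin M → ℝ) → X × ℝ → ℝ := fun l w => max (1 - w.2 * flam l w.1) 0
  set q : (Fin M → ℝ) → X × ℝ → ℝ := fun l w => min (loss l w) B
  have hflam_meas : Measurable (Function.uncurry flam) := by
    have : Function.uncurry flam = fun a => ∑ j, a.1 j * φ j a.2 := funext fun a => hflam a.1 a.2
    rw [this]
    exact Finset.measurable_sum _ fun j _ => ((measurable_pi_apply j).comp measurable_fst).mul
      ((hφmeas j).comp measurable_snd)
  have hflx : ∀ x, Measurable fun l => flam l x := fun x =>
    hflam_meas.comp measurable_prodMk_right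
  have hloss_meas : Measurable (Function.uncurry loss) :=
    (measurable_const.sub ((measurable_snd.comp measurable_snd).mul (hflam_meas.comp
      (measurable_fst.prodMk (measurable_fst.comp measurable_snd))))).max measurable_const
  have hq : Measurable (Function.uncurry q) := hloss_meas.min measurable_const
  have hB : ∀ l w, q l w ∈ Set.Icc 0 B := fun l w =>
    ⟨le_min (le_max_right _ _) hB0, min_le_right _ _⟩
  have hπgood : ∀ᵐ l ∂π, ∑ j, |l j| ≤ R := hπsupp
  have hpgood : ∀ᵐ l ∂p, ∑ j, |l j| ≤ R := hp.ae_le hπgood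
  have hPgood : ∀ᵐ w ∂P, (w.2 = 1 ∨ w.2 = -1) ∧ ∀ j, |φ j w.1| ≤ Lφ := by
    refine hlabels.and (ae_all_iff.2 fun j => ?_)
    have h := hφbound j
    rw [hPX] at h
    exact ae_of_ae_map measurable_fst.aemeasurable h
  have hzgood : ∀ᵐ z ∂(Measure.pi fun _ : Fin n => P),
      ∀ i, ((z i).2 = 1 ∨ (z i).2 = -1) ∧ ∀ j, |φ j (z i).1| ≤ Lφ :=
    Filter.eventually_all.2 fun i =>
      (Measure.tendsto_eval_ae_ae (μ := fun _ : Fin n => P)).eventually hPgood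
  have hflam_le : ∀ l x, ∑ j, |l j| ≤ R → (∀ j, |φ j x| ≤ Lφ) → |flam l x| ≤ R * Lφ :=
    fun l x hl hx => by rw [hflam]; exact abs_sum_mul_le hLφ.le hl hx
  have hlq : ∀ l w, ∑ j, |l j| ≤ R → ((w.2 = 1 ∨ w.2 = -1) ∧ ∀ j, |φ j w.1| ≤ Lφ) →
      loss l w = q l w := fun l w hl hw => by
    have h := abs_le.1 (hflam_le l w.1 hl hw.2)
    refine (min_eq_left (max_le ?_ hB0)).symm
    rcases hw.1 with hy | hy <;> rw [hy] <;> linarith [h.1, h.2]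
  have hSm : ∀ m z, Measurable (cumLoss (n := n) q m z) := fun m z =>
    (measurable_uncurry_cumLoss hq n m).comp measurable_prodMk_left
  have hS0 : ∀ m z l, 0 ≤ cumLoss (n := n) q m z l := cumLoss_nonneg fun l w => (hB l w).1
  have hθ' : ∀ m z, θ m z = gibbsDensity π β (cumLoss loss m z) := fun m z =>
    funext fun l => hθ m z l
  set H : ℕ → (X × ℝ) × (Fin n → X × ℝ) → ℝ := fun m a =>
    ∫ l, gibbsDensity π β (cumLoss q m a.2) l * q l a.1 ∂π
  have hHm : ∀ m, Measurable (H m) := measurable_integral_gibbsDensity_mul β hq hq n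
  have hHB : ∀ m a, H m a ∈ Set.Icc 0 B := integral_gibbsDensity_cumLoss_mul_mem_Icc hβpos hq hB
  have hn : (0 : ℝ) < n + 1 := by positivity
  have hpoint : ∀ z : Fin n → X × ℝ,
      (∀ i, ((z i).2 = 1 ∨ (z i).2 = -1) ∧ ∀ j, |φ j (z i).1| ≤ Lφ) → ∀ w : X × ℝ,
      ((w.2 = 1 ∨ w.2 = -1) ∧ ∀ j, |φ j w.1| ≤ Lφ) →
      max (1 - w.2 * fhat z w.1) 0 ≤
        ((n : ℝ) + 1)⁻¹ * ∑ m ∈ Finset.range (n + 1), H m (w, z) := by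
    intro z hz w hw
    have hcum : ∀ m l, ∑ j, |l j| ≤ R → cumLoss loss m z l = cumLoss q m z l := fun m l hl =>
      Finset.sum_congr rfl fun i _ => hlq l _ hl (hz i)
    have hgibbs : ∀ m, θ m z =ᵐ[π] gibbsDensity π β (cumLoss q m z) := fun m => by
      have hden : ∫ l, Real.exp (-(cumLoss loss m z l) / β) ∂π
          = ∫ l, Real.exp (-(cumLoss q m z l) / β) ∂π := by
        refine integral_congr_ae ?_
        filter_upwards [hπgood] with l hl
        rw [hcum m l hl]
      filter_upwards [hπgood] with l hl
      rw [hθ', gibbsDensity, gibbsDensity, hden, hcum m l hl]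
    have hterm : ∀ m, 1 - w.2 * ∫ l, θ m z l * flam l w.1 ∂π ≤ H m (w, z) := fun m => by
      have hcongr : ∫ l, θ m z l * flam l w.1 ∂π
          = ∫ l, gibbsDensity π β (cumLoss q m z) l * flam l w.1 ∂π := by
        refine integral_congr_ae ?_
        filter_upwards [hgibbs m] with l hl
        rw [hl]
      rw [hcongr]
      refine one_sub_mul_integral_le_of_hinge_eq (gibbsDensity_nonneg _ _ _)
        (integrable_gibbsDensity hβpos (hSm m z) (hS0 m z))
        (integral_gibbsDensity hβpos (hSm m z) (hS0 m z))
        (integrable_gibbsDensity_mul hβpos (hSm m z) (hS0 m z) (hflx _).aemeasurable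
          (B := R * Lφ) ?_)
        (integrable_gibbsDensity_mul hβpos (hSm m z) (hS0 m z)
          (hq.comp measurable_prodMk_right).aemeasurable (B := B) (ae_of_all _ fun l => ?_)) ?_
      · filter_upwards [hπgood] with l hl using hflam_le l _ hl hw.2
      · change |q l w| ≤ B
        rw [abs_of_nonneg (hB l w).1]
        exact (hB l w).2
      · filter_upwards [hπgood] with l hl using hlq l w hl hw
    refine max_le ?_ (mul_nonneg (inv_nonneg.2 hn.le)
      (Finset.sum_nonneg fun m _ => (hHB m _).1))
    have hsum := Finset.sum_le_sum fun m (_ : m ∈ Finset.range (n + 1)) => hterm m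
    rw [Finset.sum_sub_distrib, ← Finset.mul_sum] at hsum
    simp only [Finset.sum_const, Finset.card_range, nsmul_eq_mul, mul_one, Nat.cast_add,
      Nat.cast_one] at hsum
    have h := mul_le_mul_of_nonneg_left hsum (inv_nonneg.2 hn.le)
    rw [mul_sub, inv_mul_cancel₀ hn.ne'] at h
    rw [hfhat]
    linarith
  have hHw : ∀ m z, Integrable (fun w => H m (w, z)) P := fun m z =>
    integrable_of_mem_Icc ((hHm m).comp measurable_prodMk_right) fun w => hHB m _
  have hHz : ∀ m, Integrable (fun z => ∫ w, H m (w, z) ∂P) (Measure.pi fun _ : Fin n => P) :=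
    fun m => (integrable_of_mem_Icc (hHm m) (hHB m)).integral_prod_right
  have hrisk : ∀ᵐ z ∂(Measure.pi fun _ : Fin n => P),
      ∫ w, max (1 - w.2 * fhat z w.1) 0 ∂P ≤
        ((n : ℝ) + 1)⁻¹ * ∑ m ∈ Finset.range (n + 1), ∫ w, H m (w, z) ∂P := by
    filter_upwards [hzgood] with z hz
    rw [← integral_finsetSum _ fun m _ => hHw m z, ← integral_const_mul]
    refine integral_mono_of_nonneg (ae_of_all _ fun w => le_max_right _ _)
      ((integrable_finsetSum _ fun m _ => hHw m z).const_mul _) ?_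
    filter_upwards [hPgood] with w hw using hpoint z hz w hw
  have hfhat_meas : Measurable fun a : X × (Fin n → X × ℝ) => fhat a.2 a.1 := by
    simp only [hfhat, hθ']
    exact measurable_const.mul (Finset.measurable_sum _ fun m _ =>
      measurable_integral_gibbsDensity_mul β hloss_meas hflam_meas n m)
  have hrisk_meas : Measurable fun z : Fin n → X × ℝ =>
      ∫ w, max (1 - w.2 * fhat z w.1) 0 ∂P := by
    have h : Measurable fun a : (Fin n → X × ℝ) × (X × ℝ) =>
        max (1 - a.2.2 * fhat a.1 a.2.1) 0 :=
      (measurable_const.sub ((measurable_snd.comp measurable_snd).mul (hfhat_meas.comp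
        ((measurable_fst.comp measurable_snd).prodMk measurable_fst)))).max measurable_const
    exact h.stronglyMeasurable.integral_prod_right'.measurable
  have hrhs_int : Integrable (fun z => ((n : ℝ) + 1)⁻¹ *
      ∑ m ∈ Finset.range (n + 1), ∫ w, H m (w, z) ∂P) (Measure.pi fun _ : Fin n => P) :=
    (integrable_finsetSum _ fun m _ => hHz m).const_mul _
  have hrisk_int : Integrable (fun z : Fin n → X × ℝ =>
      ∫ w, max (1 - w.2 * fhat z w.1) 0 ∂P) (Measure.pi fun _ : Fin n => P) := by
    refine hrhs_int.mono' hrisk_meas.aestronglyMeasurable ?_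
    filter_upwards [hrisk] with z hz
    exact (Real.norm_of_nonneg (integral_nonneg fun w => le_max_right _ _)).trans_le hz
  have hmono := integral_mono_ae hrisk_int hrhs_int hrisk
  rw [integral_const_mul, integral_finsetSum _ fun m _ => hHz m] at hmono
  have hpac := mul_le_mul_of_nonneg_left
    (sum_integral_risk_gibbs_le hp hllr hβpos hq hB P n) (inv_nonneg.2 hn.le)
  have hpq : ∫ l, ∫ w, q l w ∂P ∂p = ∫ l, ∫ w, loss l w ∂P ∂p := by
    refine integral_congr_ae ?_
    filter_upwards [hpgood] with l hl
    refine integral_congr_ae ?_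
    filter_upwards [hPgood] with w hw using (hlq l w hl hw).symm
  have hloss_int : Integrable (fun l => ∫ w, loss l w ∂P) p := by
    refine (hexc.add (integrable_const c)).congr (ae_of_all _ fun l => ?_)
    exact sub_add_cancel _ c
  rw [integral_sub hrisk_int (integrable_const c), integral_sub hloss_int (integrable_const c)]
  simp only [integral_const, probReal_univ, one_smul]
  have hexpand : ((n : ℝ) + 1)⁻¹ * ((n + 1) * ∫ l, ∫ w, q l w ∂P ∂p + β * ∫ l, llr p π l ∂p
      + (n + 1) * (B ^ 2 / (2 * β))) = ∫ l, ∫ w, loss l w ∂P ∂p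
      + β * (∫ l, Real.log ((p.rnDeriv π l).toReal) ∂p) / (n + 1) + B ^ 2 / (2 * β) := by
    rw [hpq]
    simp only [llr]
    field_simp
  have hconst : B ^ 2 / (2 * β) ≤ 2 * B ^ 2 / β * Real.exp (B / β) := by
    have h1 : 1 ≤ Real.exp (B / β) := Real.one_le_exp (div_nonneg hB0 hβpos.le)
    have h2 : 0 ≤ B ^ 2 / β := by positivity
    have h3 : B ^ 2 / (2 * β) = B ^ 2 / β / 2 := by field_simp
    have h4 : 2 * B ^ 2 / β = 2 * (B ^ 2 / β) := by ring
    rw [h3, h4]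
    nlinarith
  rw [hexpand] at hpac
  linarith [hmono.trans hpac]
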